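/- Let $K$ be a field of characteristic zero, let $(A,\cdot)$ be a commutative associative $K$-algebra (not necessarily unital), and let $(V,\cdot_V,\mu)$ be an $A$-module commutative associative algebra, i.e. $(V,\cdot_V)$ is a commutative associative $K$-algebra and $\mu : A \to \operatorname{End}(V)$ is a linear map with $\mu(x\cdot y)=\mu(x)\mu(y)$ and $\mu(x)(a\cdot_V b)=(\mu(x)a)\cdot_V b$ for all $x,y\in A$, $a,b\in V$. Let $R : V\to A$ be a weighted relative Rota-Baxter operator of weight $\lambda\in K$, i.e. a linear map with $R(a)\cdot R(b)=R\big(\mu(R(a))b+\mu(R(b))a+\lambda\, a\cdot_V b\big)$ for all $a,b\in V$. Then $V$ is a commutative dendriform trialgebra under the operations $a*b=\lambda\,a\cdot_V b$ and $a\vartriangleright b=\mu(R(a))b$; that is, $*$ and $\vartriangleright$ are bilinear, $(V,*)$ is a commutative associative algebra, and for all $a,b,c\in V$ \[ (a\vartriangleright b+b\vartriangleright a+a*b)\vartriangleright c=a\vartriangleright(b\vartriangleright c),\qquad (a\vartriangleright b)*c=a\vartriangleright(b*c). \] -/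

import Mathlib

/-- `f` is `K`-bilinear. -/
def IsBilin (K : Type*) [Field K] {A B C : Type*} [AddCommGroup A] [Module K A]
    [AddCommGroup B] [Module K B] [AddCommGroup C] [Module K C] (f : A → B → C) : Prop :=
  (∀ a a' b, f (a + a') b = f a b + f a' b) ∧
  (∀ (c : K) (a : A) (b : B), f (c • a) b = c • f a b) ∧
  (∀ a b b', f a (b + b') = f a b + f a b') ∧
  (∀ (c : K) (a : A) (b : B), f a (c • b) = c • f a b)

/-- `(A, m)` is a (not necessarily unital) commutative associative `K`-algebra. -/
def IsCommAssoc (K : Type*) [Field K] {A : Type*} [AddCommGroup A] [Module K A]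
    (m : A → A → A) : Prop :=
  IsBilin K m ∧ (∀ x y, m x y = m y x) ∧ (∀ x y z, m (m x y) z = m x (m y z))

/-- `(V, mV, μ)` is an `(A, m)`-module commutative associative algebra. -/
def IsModuleCommAssoc {K A V : Type*} [Field K] [AddCommGroup A] [Module K A]
    [AddCommGroup V] [Module K V] (m : A → A → A) (mV : V → V → V)
    (μ : A →ₗ[K] Module.End K V) : Prop :=
  IsCommAssoc K mV ∧
  (∀ x y, μ (m x y) = μ x * μ y) ∧
  (∀ x a b, μ x (mV a b) = mV (μ x a) b)

/-- The linear map `R : V → A` is a weighted relative Rota-Baxter operator of weight `lam`. -/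
def IsWeightedRelRotaBaxter {K A V : Type*} [Field K] [AddCommGroup A] [Module K A]
    [AddCommGroup V] [Module K V] (m : A → A → A) (mV : V → V → V)
    (μ : A →ₗ[K] Module.End K V) (lam : K) (R : V →ₗ[K] A) : Prop :=
  ∀ a b, m (R a) (R b) = R (μ (R a) b + μ (R b) a + lam • mV a b)

/-- `(A, m, tr)` is a commutative dendriform trialgebra. The product acting on the left-hand side
of the first identity is the total product `x ▷ y + y ▷ x + x ∗ y`, where `x ∗ y = m x y` and
`x ▷ y = tr x y`. -/
def IsCommDendriformTrialgebra (K : Type*) [Field K] {A : Type*} [AddCommGroup A] [Module K A]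
    (m tr : A → A → A) : Prop :=
  IsCommAssoc K m ∧ IsBilin K tr ∧
  (∀ x y z, tr (tr x y + tr y x + m x y) z = tr x (tr y z)) ∧
  (∀ x y z, m (tr x y) z = tr x (m y z))

theorem stmt10 {K A V : Type*} [Field K] [CharZero K] [AddCommGroup A] [Module K A]
    [AddCommGroup V] [Module K V]
    (m : A → A → A) (mV : V → V → V) (μ : A →ₗ[K] Module.End K V) (lam : K) (R : V →ₗ[K] A)
    (hA : IsCommAssoc K m) (hV : IsModuleCommAssoc m mV μ)
    (hR : IsWeightedRelRotaBaxter m mV μ lam R) :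
    IsCommDendriformTrialgebra K (fun a b => lam • mV a b) (fun a b => μ (R a) b) := by
  obtain ⟨⟨⟨add_left, smul_left, add_right, smul_right⟩, comm, assoc⟩, hmul, hact⟩ := hV
  refine ⟨⟨⟨?_, ?_, ?_, ?_⟩, ?_, ?_⟩, ⟨?_, ?_, ?_, ?_⟩, ?_, ?_⟩
  · intro a a' b
    simp only [add_left, smul_add]
  · intro c a b
    simp only [smul_left, smul_comm lam c]
  · intro a b b'
    simp only [add_right, smul_add]
  · intro c a b
    simp only [smul_right, smul_comm lam c]
  · intro a b
    simp only [comm a b]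
  · intro a b c
    simp only [smul_left, smul_right, assoc]
  · intro a a' b
    simp only [map_add, LinearMap.add_apply]
  · intro c a b
    simp only [map_smul, LinearMap.smul_apply]
  · intro a b b'
    simp only [map_add]
  · intro c a b
    simp only [map_smul]
  · intro a b c
    change μ (R (μ (R a) b + μ (R b) a + lam • mV a b)) c = μ (R a) (μ (R b) c)
    rw [← hR a b, hmul, Module.End.mul_apply]
  · intro a b c
    simp only [map_smul, hact]
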